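/- Let ε ∈ ℝ and let q : ℝ³ → ℝ be a smooth function of (x,y,t) satisfying the linearisable equation q_tt = q_t·q_xx + 3q_x·q_xt − 3q_x²·q_xx + ε·q_xxx and its symmetry q_y = 2q_x·q_t − q_x³ + ε·q_xx at every point. Then u = q_x and w = q_t form a solution of the Mikhalev system. -/

import Mathlib

/-- Partial derivative with respect to the first variable `x`. -/
noncomputable def pdx (u : ℝ → ℝ → ℝ → ℝ) (x y t : ℝ) : ℝ := deriv (fun s => u s y t) x

/-- Partial derivative with respect to the second variable `y`. -/
noncomputable def pdy (u : ℝ → ℝ → ℝ → ℝ) (x y t : ℝ) : ℝ := deriv (fun s => u x s t) y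

/-- Partial derivative with respect to the third variable `t`. -/
noncomputable def pdt (u : ℝ → ℝ → ℝ → ℝ) (x y t : ℝ) : ℝ := deriv (fun s => u x y s) t

/-- Smoothness of a function of three real variables. -/
def Smooth3 (u : ℝ → ℝ → ℝ → ℝ) : Prop :=
  ContDiff ℝ (⊤ : ℕ∞) (fun p : ℝ × ℝ × ℝ => u p.1 p.2.1 p.2.2)

/-- The Mikhalev system: `u_t = w_x` and `u_y = w_t - u w_x + w u_x`. -/
def Mikhalev (u w : ℝ → ℝ → ℝ → ℝ) : Prop :=
  ∀ x y t : ℝ,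
    pdt u x y t = pdx w x y t ∧
    pdy u x y t = pdt w x y t - u x y t * pdx w x y t + w x y t * pdx u x y t
section PartialDerivatives

variable {u : ℝ → ℝ → ℝ → ℝ}

/-- The function of a triple obtained by uncurrying. -/
def uncurry3 (u : ℝ → ℝ → ℝ → ℝ) (p : ℝ × ℝ × ℝ) : ℝ := u p.1 p.2.1 p.2.2

theorem Smooth3.hasFDerivAt (hu : Smooth3 u) (p : ℝ × ℝ × ℝ) :
    HasFDerivAt (uncurry3 u) (fderiv ℝ (uncurry3 u) p) p :=
  (ContDiff.differentiable hu (by simp) p).hasFDerivAt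

theorem Smooth3.hasDerivAt_fst (hu : Smooth3 u) (x y t : ℝ) :
    HasDerivAt (fun s => u s y t) (fderiv ℝ (uncurry3 u) (x, y, t) (1, 0, 0)) x :=
  HasFDerivAt.comp_hasDerivAt (l := uncurry3 u) x (hu.hasFDerivAt (x, y, t))
    ((hasDerivAt_id x).prodMk ((hasDerivAt_const x y).prodMk (hasDerivAt_const x t)))

theorem Smooth3.hasDerivAt_snd (hu : Smooth3 u) (x y t : ℝ) :
    HasDerivAt (fun s => u x s t) (fderiv ℝ (uncurry3 u) (x, y, t) (0, 1, 0)) y :=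
  HasFDerivAt.comp_hasDerivAt (l := uncurry3 u) y (hu.hasFDerivAt (x, y, t))
    ((hasDerivAt_const y x).prodMk ((hasDerivAt_id y).prodMk (hasDerivAt_const y t)))

theorem Smooth3.hasDerivAt_trd (hu : Smooth3 u) (x y t : ℝ) :
    HasDerivAt (fun s => u x y s) (fderiv ℝ (uncurry3 u) (x, y, t) (0, 0, 1)) t :=
  HasFDerivAt.comp_hasDerivAt (l := uncurry3 u) t (hu.hasFDerivAt (x, y, t))
    ((hasDerivAt_const t x).prodMk ((hasDerivAt_const t y).prodMk (hasDerivAt_id t)))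

theorem Smooth3.uncurry3_pdx (hu : Smooth3 u) :
    uncurry3 (pdx u) = fun p => fderiv ℝ (uncurry3 u) p (1, 0, 0) :=
  funext fun p => (hu.hasDerivAt_fst p.1 p.2.1 p.2.2).deriv

theorem Smooth3.uncurry3_pdy (hu : Smooth3 u) :
    uncurry3 (pdy u) = fun p => fderiv ℝ (uncurry3 u) p (0, 1, 0) :=
  funext fun p => (hu.hasDerivAt_snd p.1 p.2.1 p.2.2).deriv

theorem Smooth3.uncurry3_pdt (hu : Smooth3 u) :
    uncurry3 (pdt u) = fun p => fderiv ℝ (uncurry3 u) p (0, 0, 1) :=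
  funext fun p => (hu.hasDerivAt_trd p.1 p.2.1 p.2.2).deriv

theorem Smooth3.contDiff_fderiv_apply (hu : Smooth3 u) (v : ℝ × ℝ × ℝ) :
    ContDiff ℝ (⊤ : ℕ∞) (fun p => fderiv ℝ (uncurry3 u) p v) :=
  (ContDiff.fderiv_right (m := (⊤ : ℕ∞)) hu (by simp)).clm_apply contDiff_const

theorem Smooth3.smooth3_pdx (hu : Smooth3 u) : Smooth3 (pdx u) := by
  change ContDiff ℝ (⊤ : ℕ∞) (uncurry3 (pdx u))
  rw [hu.uncurry3_pdx]
  exact hu.contDiff_fderiv_apply _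

theorem Smooth3.smooth3_pdy (hu : Smooth3 u) : Smooth3 (pdy u) := by
  change ContDiff ℝ (⊤ : ℕ∞) (uncurry3 (pdy u))
  rw [hu.uncurry3_pdy]
  exact hu.contDiff_fderiv_apply _

theorem Smooth3.smooth3_pdt (hu : Smooth3 u) : Smooth3 (pdt u) := by
  change ContDiff ℝ (⊤ : ℕ∞) (uncurry3 (pdt u))
  rw [hu.uncurry3_pdt]
  exact hu.contDiff_fderiv_apply _

theorem Smooth3.fderiv_fderiv_apply_comm (hu : Smooth3 u) (p v w : ℝ × ℝ × ℝ) :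
    fderiv ℝ (fun p => fderiv ℝ (uncurry3 u) p v) p w =
      fderiv ℝ (fun p => fderiv ℝ (uncurry3 u) p w) p v := by
  have hd : DifferentiableAt ℝ (fderiv ℝ (uncurry3 u)) p :=
    (ContDiff.fderiv_right (m := (⊤ : ℕ∞)) hu (by simp)).differentiable (by simp) p
  have hs : IsSymmSndFDerivAt ℝ (uncurry3 u) p :=
    (ContDiff.contDiffAt hu).isSymmSndFDerivAt
      (by rw [minSmoothness_of_isRCLikeNormedField]; exact WithTop.coe_le_coe.2 le_top)
  rw [fderiv_clm_apply hd (differentiableAt_const v),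
    fderiv_clm_apply hd (differentiableAt_const w)]
  simpa using hs.eq w v

theorem Smooth3.pdt_pdx (hu : Smooth3 u) (x y t : ℝ) :
    pdt (pdx u) x y t = pdx (pdt u) x y t := by
  refine (hu.smooth3_pdx.hasDerivAt_trd x y t).deriv.trans
    (Eq.trans ?_ (hu.smooth3_pdt.hasDerivAt_fst x y t).deriv.symm)
  rw [hu.uncurry3_pdx, hu.uncurry3_pdt]
  exact hu.fderiv_fderiv_apply_comm _ _ _

theorem Smooth3.pdy_pdx (hu : Smooth3 u) (x y t : ℝ) :
    pdy (pdx u) x y t = pdx (pdy u) x y t := by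
  refine (hu.smooth3_pdx.hasDerivAt_snd x y t).deriv.trans
    (Eq.trans ?_ (hu.smooth3_pdy.hasDerivAt_fst x y t).deriv.symm)
  rw [hu.uncurry3_pdx, hu.uncurry3_pdy]
  exact hu.fderiv_fderiv_apply_comm _ _ _

theorem Smooth3.hasDerivAt_pdx (hu : Smooth3 u) (x y t : ℝ) :
    HasDerivAt (fun s => u s y t) (pdx u x y t) x :=
  (hu.hasDerivAt_fst x y t).differentiableAt.hasDerivAt

end PartialDerivatives

theorem stmt_14 (ε : ℝ) (q : ℝ → ℝ → ℝ → ℝ) (hq : Smooth3 q)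
    (heq : ∀ x y t : ℝ, pdt (pdt q) x y t =
      pdt q x y t * pdx (pdx q) x y t
        + 3 * pdx q x y t * pdt (pdx q) x y t
        - 3 * (pdx q x y t) ^ 2 * pdx (pdx q) x y t
        + ε * pdx (pdx (pdx q)) x y t)
    (hsym : ∀ x y t : ℝ, pdy q x y t =
      2 * pdx q x y t * pdt q x y t - (pdx q x y t) ^ 3 + ε * pdx (pdx q) x y t) :
    Mikhalev (pdx q) (pdt q) := by
  intro x y t
  refine ⟨hq.pdt_pdx x y t, ?_⟩
  have hx := hq.smooth3_pdx.hasDerivAt_pdx x y t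
  have h := (((hx.const_mul 2).mul (hq.smooth3_pdt.hasDerivAt_pdx x y t)).sub (hx.pow 3)).add
    ((hq.smooth3_pdx.smooth3_pdx.hasDerivAt_pdx x y t).const_mul ε)
  have hy : pdx (pdy q) x y t = _ :=
    (h.congr_of_eventuallyEq (Filter.Eventually.of_forall fun s => hsym s y t)).deriv
  rw [hq.pdy_pdx, hy, heq, hq.pdt_pdx]
  push_cast
  ring
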